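/- arXiv:2211.08648 — 4 statements merged into one kernel-verified Lean document; each statement's English description precedes it below -/
import Mathlib

section
/- For distinct vertices s ≠ t, the set of minimal pairs of P(s,t) has cardinality at most min(k, |V| − 1), where k is the number of distinct values taken by δ on the edges of G and |V| is the number of vertices of G. -/
open SimpleGraph

/-- The quality of a walk: the minimum of `δ` over its edges, `⊤` if it has no
edges. -/
noncomputable def walkQuality {V : Type*} {G : SimpleGraph V} (δ : Sym2 V → ℝ)
    {s t : V} (p : G.Walk s t) : WithTop ℝ :=
  (p.edges.map δ).minimum

/-- `P(s,t)`: the set of pairs `(len(p), q(p))` over walks `p` from `s` to `t`. -/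
def pairSet {V : Type*} (G : SimpleGraph V) (δ : Sym2 V → ℝ) (s t : V) :
    Set (ℕ × WithTop ℝ) :=
  {x | ∃ p : G.Walk s t, x = (p.length, walkQuality δ p)}

theorem walkQuality_anti {V : Type*} {G : SimpleGraph V} (δ : Sym2 V → ℝ)
    {s t u v : V} {p : G.Walk s t} {p' : G.Walk u v} (h : p.edges ⊆ p'.edges) :
    walkQuality δ p' ≤ walkQuality δ p :=
  List.minimum_anti (List.map_subset δ h)

theorem exists_edge_walkQuality_eq {V : Type*} {G : SimpleGraph V} (δ : Sym2 V → ℝ)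
    {s t : V} (hst : s ≠ t) (p : G.Walk s t) :
    ∃ e ∈ G.edgeSet, (δ e : WithTop ℝ) = walkQuality δ p := by
  have hne : walkQuality δ p ≠ ⊤ := by
    intro h
    have hnil : p.edges = [] := by simpa [walkQuality, List.minimum_eq_top] using h
    cases p with
    | nil => exact hst rfl
    | cons h q => simp at hnil
  obtain ⟨r, hr⟩ := WithTop.ne_top_iff_exists.mp hne
  obtain ⟨e, he, rfl⟩ := List.mem_map.mp (List.minimum_mem hr.symm)
  exact ⟨e, p.edges_subset_edgeSet he, hr⟩

/-- for `s ≠ t`, the set of minimal pairs of `P(s,t)` has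
cardinality at most `min(k, |V| − 1)`, where `k` is the number of distinct values
taken by `δ` on the edges of `G`. A pair `(d₁,q₁)` dominates `(d₂,q₂)` iff
`d₁ ≤ d₂` and `q₁ ≥ q₂`, strictly if moreover the pairs are distinct; a pair of
`P(s,t)` is minimal if no pair of `P(s,t)` strictly dominates it. -/
theorem stmt_10 {V : Type*} [Fintype V] (G : SimpleGraph V) (δ : Sym2 V → ℝ)
    (s t : V) (hst : s ≠ t) :
    {x ∈ pairSet G δ s t |
        ∀ y ∈ pairSet G δ s t, ¬(y.1 ≤ x.1 ∧ x.2 ≤ y.2 ∧ y ≠ x)}.encard ≤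
      ((min ((δ '' G.edgeSet).ncard) (Fintype.card V - 1) : ℕ) : ℕ∞) := by
  classical
  let S := {x ∈ pairSet G δ s t |
    ∀ y ∈ pairSet G δ s t, ¬(y.1 ≤ x.1 ∧ x.2 ≤ y.2 ∧ y ≠ x)}
  have hfst : S.InjOn Prod.fst := by
    intro x hx y hy hxy
    by_contra hne
    rcases le_total x.2 y.2 with h | h
    · exact hx.2 y hy.1 ⟨hxy.ge, h, Ne.symm hne⟩
    · exact hy.2 x hx.1 ⟨hxy.le, h, hne⟩
  have hsnd : S.InjOn Prod.snd := by
    intro x hx y hy hxy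
    by_contra hne
    rcases le_total x.1 y.1 with h | h
    · exact hy.2 x hx.1 ⟨h, hxy.ge, hne⟩
    · exact hx.2 y hy.1 ⟨h, hxy.le, Ne.symm hne⟩
  have hlen : Prod.fst '' S ⊆ Set.Icc 1 (Fintype.card V - 1) := by
    rintro _ ⟨_, ⟨⟨p, rfl⟩, hmin⟩, rfl⟩
    refine ⟨Nat.one_le_iff_ne_zero.mpr fun h => hst (Walk.eq_of_length_eq_zero h), ?_⟩
    have hlt := p.bypass_isPath.length_lt
    by_contra hgt
    refine hmin _ ⟨p.bypass, rfl⟩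
      ⟨p.length_bypass_le_length, walkQuality_anti δ p.edges_bypass_subset_edges, fun h => ?_⟩
    have := congrArg Prod.fst h
    dsimp only at this hgt
    omega
  have hqual : Prod.snd '' S ⊆ (fun r : ℝ => (r : WithTop ℝ)) '' (δ '' G.edgeSet) := by
    rintro _ ⟨_, ⟨⟨p, rfl⟩, -⟩, rfl⟩
    obtain ⟨e, he, h⟩ := exists_edge_walkQuality_eq δ hst p
    exact ⟨δ e, ⟨e, he, rfl⟩, h⟩
  rw [Nat.mono_cast.map_min]
  refine le_min ?_ ?_
  · rw [((Set.toFinite G.edgeSet).image δ).cast_ncard_eq, ← hsnd.encard_image]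
    exact (Set.encard_le_encard hqual).trans (Set.encard_image_le _ _)
  · rw [← hfst.encard_image]
    refine (Set.encard_le_encard hlen).trans ?_
    rw [← Finset.coe_Icc, Set.encard_coe_eq_coe_finsetCard, Nat.card_Icc,
      Nat.add_sub_cancel]
end

section
/- For all vertices s, t and every real number w, dist^w(s,t) equals the minimum, taken in ℕ∞ over a possibly empty set, of {d : (d,q) is a minimal pair of P(s,t) with q ≥ w}, where q ≥ w is the comparison of q ∈ WithTop ℝ with the real number w. -/
open SimpleGraph

/-- The `w`-constrained distance in `G` with edge qualities `δ`. -/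
noncomputable def cdist {V : Type*} (G : SimpleGraph V) (δ : Sym2 V → ℝ) (w : ℝ)
    (s t : V) : ℕ∞ :=
  sInf {n : ℕ∞ | ∃ p : G.Walk s t, (∀ e ∈ p.edges, w ≤ δ e) ∧ (p.length : ℕ∞) = n}

theorem coe_le_walkQuality_iff {V : Type*} {G : SimpleGraph V} (δ : Sym2 V → ℝ) (w : ℝ)
    {s t : V} (p : G.Walk s t) :
    (w : WithTop ℝ) ≤ walkQuality δ p ↔ ∀ e ∈ p.edges, w ≤ δ e := by
  unfold walkQuality
  induction p.edges with
  | nil => simp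
  | cons a l ih => simp [List.minimum_cons, ih]

theorem walkQuality_mem_insert_range {V : Type*} {G : SimpleGraph V} (δ : Sym2 V → ℝ)
    {s t : V} (p : G.Walk s t) :
    walkQuality δ p ∈ insert ⊤ (Set.range fun e => (δ e : WithTop ℝ)) := by
  unfold walkQuality
  induction p.edges with
  | nil => simp
  | cons a l ih =>
    rw [List.map_cons, List.minimum_cons]
    rcases min_choice (δ a : WithTop ℝ) (l.map δ).minimum with h | h <;> rw [h]
    · exact Or.inr ⟨a, rfl⟩
    · exact ih

theorem finite_snd_image_pairSet {V : Type*} [Finite V] (G : SimpleGraph V) (δ : Sym2 V → ℝ)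
    (s t : V) : (Prod.snd '' pairSet G δ s t).Finite := by
  refine ((Set.finite_range fun e => (δ e : WithTop ℝ)).insert ⊤).subset ?_
  rintro _ ⟨_, ⟨p, rfl⟩, rfl⟩
  exact walkQuality_mem_insert_range δ p

/-- Every pair of `P(s,t)` of quality at least `w` can be replaced by a minimal pair of quality
at least `w` that is no longer. -/
theorem exists_minimal_pair {V : Type*} [Finite V] (G : SimpleGraph V) (δ : Sym2 V → ℝ)
    {s t : V} {w : WithTop ℝ} {x : ℕ × WithTop ℝ} (hx : x ∈ pairSet G δ s t) (hw : w ≤ x.2) :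
    ∃ (d : ℕ) (q : WithTop ℝ), (d, q) ∈ pairSet G δ s t ∧
      (∀ y ∈ pairSet G δ s t, ¬(y.1 ≤ d ∧ q ≤ y.2 ∧ y ≠ (d, q))) ∧ w ≤ q ∧ d ≤ x.1 := by
  classical
  have hex : ∃ d, ∃ q, (d, q) ∈ pairSet G δ s t ∧ w ≤ q := ⟨x.1, x.2, hx, hw⟩
  obtain ⟨q₀, hq₀, hwq₀⟩ := Nat.find_spec hex
  have hfin : {q | (Nat.find hex, q) ∈ pairSet G δ s t}.Finite :=
    (finite_snd_image_pairSet G δ s t).subset fun q hq => ⟨_, hq, rfl⟩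
  obtain ⟨q, hq, hmax⟩ := Set.exists_max_image _ id hfin ⟨q₀, hq₀⟩
  have hwq : w ≤ q := hwq₀.trans (hmax q₀ hq₀)
  refine ⟨Nat.find hex, q, hq, ?_, hwq, Nat.find_min' hex ⟨x.2, hx, hw⟩⟩
  rintro ⟨d', q'⟩ hy ⟨hd, hqq, hne⟩
  obtain rfl : d' = Nat.find hex :=
    le_antisymm hd (Nat.find_min' hex ⟨q', hy, hwq.trans hqq⟩)
  exact hne (Prod.ext rfl (le_antisymm (hmax q' hy) hqq))

/-- `dist^w(s,t)` equals the minimum (in `ℕ∞`, over a possibly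
empty set) of the lengths `d` over the minimal pairs `(d,q)` of `P(s,t)` with
`q ≥ w`. -/
theorem stmt_11 {V : Type*} [Fintype V] (G : SimpleGraph V) (δ : Sym2 V → ℝ)
    (s t : V) (w : ℝ) :
    cdist G δ w s t =
      sInf {n : ℕ∞ | ∃ (d : ℕ) (q : WithTop ℝ),
        (d, q) ∈ pairSet G δ s t ∧
        (∀ y ∈ pairSet G δ s t, ¬(y.1 ≤ d ∧ q ≤ y.2 ∧ y ≠ (d, q))) ∧
        (w : WithTop ℝ) ≤ q ∧ n = (d : ℕ∞)} := by
  apply le_antisymm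
  · refine le_sInf ?_
    rintro _ ⟨d, q, ⟨p, hp⟩, -, hw, rfl⟩
    obtain ⟨rfl, rfl⟩ := Prod.mk.inj hp
    exact sInf_le ⟨p, (coe_le_walkQuality_iff δ w p).1 hw, rfl⟩
  · refine le_sInf ?_
    rintro _ ⟨p, hp, rfl⟩
    obtain ⟨d, q, hmem, hmin, hw, hd⟩ :=
      exists_minimal_pair G δ (x := (p.length, walkQuality δ p)) ⟨p, rfl⟩
        ((coe_le_walkQuality_iff δ w p).2 hp)
    exact sInf_le_of_le ⟨d, q, hmem, hmin, hw, rfl⟩ (Nat.cast_le.2 hd)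
end

section
/- Let p be a minimal walk from s to t with at least one edge. Then q(p) is a real number (i.e., q(p) ≠ ⊤), and len(p) = dist^{w}(s,t), where w is the real number with q(p) = w. -/
open SimpleGraph

/-- `p₁` dominates `p₂` (same endpoints): `len(p₁) ≤ len(p₂)` and `q(p₁) ≥ q(p₂)`. -/
def Dominates {V : Type*} {G : SimpleGraph V} (δ : Sym2 V → ℝ) {s t : V}
    (p₁ p₂ : G.Walk s t) : Prop :=
  p₁.length ≤ p₂.length ∧ walkQuality δ p₂ ≤ walkQuality δ p₁

/-- `p₁` strictly dominates `p₂`: it dominates it and moreover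
`len(p₁) < len(p₂)` or `q(p₁) > q(p₂)`. -/
def StrictlyDominates {V : Type*} {G : SimpleGraph V} (δ : Sym2 V → ℝ) {s t : V}
    (p₁ p₂ : G.Walk s t) : Prop :=
  Dominates δ p₁ p₂ ∧ (p₁.length < p₂.length ∨ walkQuality δ p₂ < walkQuality δ p₁)

theorem le_walkQuality_iff {V : Type*} {G : SimpleGraph V} {δ : Sym2 V → ℝ} {s t : V}
    {p : G.Walk s t} {w : ℝ} :
    (w : WithTop ℝ) ≤ walkQuality δ p ↔ ∀ e ∈ p.edges, w ≤ δ e := by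
  refine ⟨fun h e he => WithTop.coe_le_coe.mp
    (h.trans (List.minimum_le_of_mem' (List.mem_map_of_mem he))), fun h =>
    List.le_minimum_of_forall_le ?_⟩
  simpa using h

theorem walkQuality_ne_top {V : Type*} {G : SimpleGraph V} (δ : Sym2 V → ℝ) {s t : V}
    {p : G.Walk s t} (hp : 0 < p.length) : walkQuality δ p ≠ ⊤ := by
  rw [walkQuality, Ne, List.minimum_eq_top, List.map_eq_nil_iff, ← List.length_eq_zero_iff,
    Walk.length_edges]
  exact hp.ne'

/-- a minimal walk `p` from `s` to `t` with at least one edge has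
real quality, i.e. `q(p) = w` for some real `w`, and `len(p) = dist^w(s,t)`. -/
theorem stmt_13 {V : Type*} [Fintype V] (G : SimpleGraph V) (δ : Sym2 V → ℝ)
    (s t : V) (p : G.Walk s t)
    (hmin : ∀ p' : G.Walk s t, ¬ StrictlyDominates δ p' p)
    (hne : 0 < p.length) :
    ∃ w : ℝ, walkQuality δ p = (w : WithTop ℝ) ∧
      (p.length : ℕ∞) = cdist G δ w s t := by
  obtain ⟨w, hw⟩ := WithTop.ne_top_iff_exists.mp (walkQuality_ne_top δ hne)
  refine ⟨w, hw.symm, le_antisymm (le_sInf ?_)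
    (sInf_le ⟨p, le_walkQuality_iff.mp hw.le, rfl⟩)⟩
  rintro _ ⟨p', hp', rfl⟩
  refine Nat.cast_le.mpr (not_lt.mp fun hlt => hmin p' ⟨⟨hlt.le, ?_⟩, Or.inl hlt⟩)
  exact hw ▸ le_walkQuality_iff.mpr hp'
end

section
/- Fix a source vertex s. For d ∈ ℕ and a vertex v, let B_d(v) ∈ WithBot (WithTop ℝ) be the supremum of q(p) over all walks p from s to v of length at most d, with B_d(v) = ⊥ if no such walk exists. Then for every vertex v and every d ∈ ℕ: B_{d+1}(v) = max( B_d(v), sup over vertices u adjacent to v of min(B_d(u), δ({u,v})) ), where δ({u,v}) is coerced into WithBot (WithTop ℝ). -/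
open SimpleGraph

/-- `B_d(v)`: the supremum, in `WithBot (WithTop ℝ)`, of the qualities of walks
from `s` to `v` of length at most `d` (`⊥` if no such walk exists, since
`sSup ∅ = ⊥` in this order). -/
noncomputable def bestQual {V : Type*} (G : SimpleGraph V) (δ : Sym2 V → ℝ)
    (s : V) (d : ℕ) (v : V) : WithBot (WithTop ℝ) :=
  sSup {x : WithBot (WithTop ℝ) |
    ∃ p : G.Walk s v, p.length ≤ d ∧ x = (walkQuality δ p : WithBot (WithTop ℝ))}

theorem walkQuality_concat {V : Type*} {G : SimpleGraph V} (δ : Sym2 V → ℝ)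
    {s u v : V} (p : G.Walk s u) (h : G.Adj u v) :
    walkQuality δ (p.concat h) = min (walkQuality δ p) (δ s(u, v)) := by
  simp [walkQuality, Walk.edges_concat, List.minimum_concat]

theorem bestQual_le_iff {V : Type*} {G : SimpleGraph V} {δ : Sym2 V → ℝ} {s : V} {d : ℕ}
    {v : V} {x : WithBot (WithTop ℝ)} :
    bestQual G δ s d v ≤ x ↔
      ∀ p : G.Walk s v, p.length ≤ d → (walkQuality δ p : WithBot (WithTop ℝ)) ≤ x := by
  refine sSup_le_iff.trans ⟨fun h p hp => h _ ⟨p, hp, rfl⟩, ?_⟩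
  rintro h _ ⟨p, hp, rfl⟩
  exact h p hp

theorem walkQuality_le_bestQual {V : Type*} {G : SimpleGraph V} (δ : Sym2 V → ℝ) {s v : V}
    {d : ℕ} (p : G.Walk s v) (hp : p.length ≤ d) :
    (walkQuality δ p : WithBot (WithTop ℝ)) ≤ bestQual G δ s d v :=
  bestQual_le_iff.1 le_rfl p hp

theorem bestQual_mono {V : Type*} (G : SimpleGraph V) (δ : Sym2 V → ℝ) (s v : V) :
    Monotone fun d => bestQual G δ s d v := fun _ _ h =>
  bestQual_le_iff.2 fun p hp => walkQuality_le_bestQual δ p (hp.trans h)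

/-- Extending a walk by an edge costs at most one step. -/
theorem min_bestQual_le {V : Type*} {G : SimpleGraph V} (δ : Sym2 V → ℝ) (s : V) (d : ℕ)
    {u v : V} (h : G.Adj u v) :
    min (bestQual G δ s d u) ((δ s(u, v) : WithTop ℝ) : WithBot (WithTop ℝ)) ≤
      bestQual G δ s (d + 1) v := by
  rw [min_le_iff, or_iff_not_imp_right]
  refine fun hδ => bestQual_le_iff.2 fun p hp => ?_
  have hq := walkQuality_le_bestQual δ (p.concat h) (d := d + 1) (by simpa using hp)
  rw [walkQuality_concat, WithBot.coe_min, min_le_iff] at hq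
  exact hq.resolve_right hδ

/-- Bellman–Ford style recurrence for the best quality reachable
within a given number of steps:
`B_{d+1}(v) = max (B_d(v)) (⨆_{u ~ v} min (B_d(u)) (δ {u,v}))`. -/
theorem stmt_16 {V : Type*} [Fintype V] (G : SimpleGraph V) (δ : Sym2 V → ℝ)
    (s : V) :
    ∀ (v : V) (d : ℕ),
      bestQual G δ s (d + 1) v =
        max (bestQual G δ s d v)
          (⨆ u ∈ {u : V | G.Adj u v},
            min (bestQual G δ s d u)
              ((δ s(u, v) : WithTop ℝ) : WithBot (WithTop ℝ))) := by
  intro v d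
  refine le_antisymm (bestQual_le_iff.2 fun p hp => ?_)
    (max_le (bestQual_mono G δ s v d.le_succ) (iSup₂_le fun u hu => min_bestQual_le δ s d hu))
  induction p using Walk.concatRec with
  | Hnil => exact le_max_of_le_left (walkQuality_le_bestQual δ _ (Nat.zero_le d))
  | @Hconcat s u v p h _ =>
    rw [walkQuality_concat, WithBot.coe_min]
    refine le_max_of_le_right (le_trans ?_ (le_iSup₂ (f := fun u (_ : u ∈ {u | G.Adj u v}) =>
      min (bestQual G δ s d u) ((δ s(u, v) : WithTop ℝ) : WithBot (WithTop ℝ))) u h))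
    exact min_le_min_right _ (walkQuality_le_bestQual δ p (by simpa using hp))
end
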